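/- Let (V, g, J) be a 2n-dimensional real inner product space with compatible almost complex structure, ω = g(J·,·), L(α) = ω ∧ α, and Λ the g-adjoint of L. Define the primitive forms P^k = ker(Λ) ∩ Λ^k V*. Then for k ≤ n, the restriction L^{n-k} : P^k → Λ^{2n-k}V* is injective. -/

import Mathlib

set_option synthInstance.maxHeartbeats 1000000
set_option maxHeartbeats 1000000

noncomputable section

open ExteriorAlgebra

/-- The vector representing a linear functional via the inner product (musical isomorphism). -/
def sharp {V : Type*} [NormedAddCommGroup V] [InnerProductSpace ℝ V] [FiniteDimensional ℝ V]
    (f : Module.Dual ℝ V) : V :=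
  (InnerProductSpace.toDual ℝ V).symm (LinearMap.toContinuousLinearMap f)

/-- The inner product induced on the dual space by the inner product of `V`. -/
def gd {V : Type*} [NormedAddCommGroup V] [InnerProductSpace ℝ V] [FiniteDimensional ℝ V]
    (f g : Module.Dual ℝ V) : ℝ :=
  inner (𝕜 := ℝ) (sharp f) (sharp g)

/-- The value of an exterior 2-form on two vectors, obtained by contracting twice. -/
def formEval {V : Type*} [AddCommGroup V] [Module ℝ V]
    (x : ExteriorAlgebra ℝ (Module.Dual ℝ V)) (u v : V) : ℝ :=
  algebraMapInv
    (CliffordAlgebra.contractLeft (Module.Dual.eval ℝ V v)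
      (CliffordAlgebra.contractLeft (Module.Dual.eval ℝ V u) x))

/-- `B` is the inner product on the exterior algebra of the dual of `V` induced by the metric:
it is determined by `⟨u₁∧…∧u_m, v₁∧…∧v_m⟩ = det(⟨uᵢ,vⱼ⟩)` together with orthogonality of
forms of distinct degrees. -/
def IsInducedInner {V : Type*} [NormedAddCommGroup V] [InnerProductSpace ℝ V]
    [FiniteDimensional ℝ V]
    (B : ExteriorAlgebra ℝ (Module.Dual ℝ V) →ₗ[ℝ] ExteriorAlgebra ℝ (Module.Dual ℝ V) →ₗ[ℝ] ℝ) :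
    Prop :=
  (∀ (m : ℕ) (u v : Fin m → Module.Dual ℝ V),
      B (ιMulti ℝ m u) (ιMulti ℝ m v) = Matrix.det (Matrix.of fun i j => gd (u i) (v j))) ∧
    ∀ (p q : ℕ), p ≠ q → ∀ x ∈ ⋀[ℝ]^p (Module.Dual ℝ V), ∀ y ∈ ⋀[ℝ]^q (Module.Dual ℝ V),
      B x y = 0

section KahlerAux

set_option linter.unusedSectionVars false

variable {V : Type*} [NormedAddCommGroup V] [InnerProductSpace ℝ V] [FiniteDimensional ℝ V]

/-- Contraction with a vector. -/
def ctr (v : V) : ExteriorAlgebra ℝ (Module.Dual ℝ V) →ₗ[ℝ] ExteriorAlgebra ℝ (Module.Dual ℝ V) :=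
  CliffordAlgebra.contractLeft (Module.Dual.eval ℝ V v)

/-- The functional dual to a vector. -/
def flt (v : V) : Module.Dual ℝ V := innerₗ V v

lemma flt_apply (v w : V) : flt v w = inner (𝕜 := ℝ) v w := rfl

lemma ctr_ι_mul (v : V) (f : Module.Dual ℝ V) (x : ExteriorAlgebra ℝ (Module.Dual ℝ V)) :
    ctr v (ι ℝ f * x) = f v • x - ι ℝ f * ctr v x :=
  CliffordAlgebra.contractLeft_ι_mul _ _ _

lemma ctr_one (v : V) : ctr v (1 : ExteriorAlgebra ℝ (Module.Dual ℝ V)) = 0 :=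
  CliffordAlgebra.contractLeft_one _ _

lemma ctr_ι (v : V) (f : Module.Dual ℝ V) :
    ctr v (ι ℝ f) = algebraMap ℝ _ (f v) :=
  CliffordAlgebra.contractLeft_ι _ _ _

lemma gd_flt (f : Module.Dual ℝ V) (v : V) : gd f (flt v) = f v := by
  have h1 : sharp (flt v) = v := by
    unfold sharp
    rw [LinearIsometryEquiv.symm_apply_eq]
    ext w
    simp [flt_apply]
  unfold gd
  rw [h1]
  unfold sharp
  rw [InnerProductSpace.toDual_symm_apply]
  rfl

lemma ctr_ιMulti (v : V) (m : ℕ) (u : Fin (m + 1) → Module.Dual ℝ V) :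
    ctr v (ιMulti ℝ (m + 1) u)
      = ∑ i : Fin (m + 1), ((-1 : ℝ) ^ (i : ℕ) * u i v) • ιMulti ℝ m (u ∘ i.succAbove) := by
  induction m with
  | zero =>
    rw [ιMulti_succ_apply, ctr_ι_mul]
    simp [ctr_one]
  | succ m ih =>
    rw [ιMulti_succ_apply, ctr_ι_mul, ih, Fin.sum_univ_succ (n := m + 1), Finset.mul_sum, sub_eq_add_neg,
      ← Finset.sum_neg_distrib]
    congr 1
    · simp
      rfl
    · refine Finset.sum_congr rfl fun i _ => ?_
      rw [ιMulti_succ_apply (v := u ∘ i.succ.succAbove), mul_smul_comm, ← neg_smul]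
      congr 1
      · simp [Matrix.vecTail, pow_succ]
      · have e : Matrix.vecTail u ∘ i.succAbove = Matrix.vecTail (u ∘ i.succ.succAbove) := by
          funext j
          simp [Matrix.vecTail]
        rw [e]
        simp

lemma ext_ind {m : ℕ} {p : ExteriorAlgebra ℝ (Module.Dual ℝ V) → Prop}
    (h0 : p 0) (hadd : ∀ x y, p x → p y → p (x + y)) (hsmul : ∀ (a : ℝ) x, p x → p (a • x))
    (hm : ∀ u : Fin m → Module.Dual ℝ V, p (ιMulti ℝ m u))
    {x : ExteriorAlgebra ℝ (Module.Dual ℝ V)} (hx : x ∈ ⋀[ℝ]^m (Module.Dual ℝ V)) : p x := by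
  rw [← ιMulti_span_fixedDegree] at hx
  refine Submodule.span_induction (p := fun x _ => p x) ?_ h0
    (fun x y _ _ => hadd x y) (fun a x _ => hsmul a x) hx
  rintro _ ⟨u, rfl⟩
  exact hm u

lemma ιMulti_mem (m : ℕ) (u : Fin m → Module.Dual ℝ V) :
    ιMulti ℝ m u ∈ ⋀[ℝ]^m (Module.Dual ℝ V) := by
  rw [← ιMulti_span_fixedDegree]
  exact Submodule.subset_span ⟨u, rfl⟩

lemma ctr_mem_zero (v : V) {x : ExteriorAlgebra ℝ (Module.Dual ℝ V)}
    (hx : x ∈ ⋀[ℝ]^0 (Module.Dual ℝ V)) : ctr v x = 0 := by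
  refine ext_ind (p := fun x => ctr v x = 0) (by simp) ?_ ?_ ?_ hx
  · intro x y h1 h2; simp [h1, h2]
  · intro a x h; simp [h]
  · intro u; simp [ctr_one]

lemma ctr_mem (v : V) {m : ℕ} {x : ExteriorAlgebra ℝ (Module.Dual ℝ V)}
    (hx : x ∈ ⋀[ℝ]^m (Module.Dual ℝ V)) : ctr v x ∈ ⋀[ℝ]^(m - 1) (Module.Dual ℝ V) := by
  cases m with
  | zero => rw [ctr_mem_zero v hx]; exact Submodule.zero_mem _
  | succ m =>
    refine ext_ind (p := fun x => ctr v x ∈ ⋀[ℝ]^m (Module.Dual ℝ V)) ?_ ?_ ?_ ?_ hx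
    · rw [map_zero]; exact Submodule.zero_mem _
    · intro x y h1 h2; rw [map_add]; exact Submodule.add_mem _ h1 h2
    · intro a x h; rw [map_smul]; exact Submodule.smul_mem _ _ h
    · intro u
      rw [ctr_ιMulti]
      exact Submodule.sum_mem _ fun i _ => Submodule.smul_mem _ _ (ιMulti_mem _ _)

lemma ctr_mul_two (v : V) {w : ExteriorAlgebra ℝ (Module.Dual ℝ V)}
    (hw : w ∈ ⋀[ℝ]^2 (Module.Dual ℝ V)) (y : ExteriorAlgebra ℝ (Module.Dual ℝ V)) :
    ctr v (w * y) = ctr v w * y + w * ctr v y := by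
  refine ext_ind (p := fun w => ctr v (w * y) = ctr v w * y + w * ctr v y) ?_ ?_ ?_ ?_ hw
  · simp
  · intro x z h1 h2
    rw [add_mul, map_add, map_add, h1, h2, add_mul, add_mul]; abel
  · intro a x h
    rw [smul_mul_assoc, map_smul, map_smul, h, smul_mul_assoc, smul_mul_assoc, smul_add]
  · intro u
    rw [ιMulti_succ_apply, ιMulti_succ_apply, ιMulti_zero_apply, mul_one, mul_assoc]
    simp only [ctr_ι_mul, ctr_ι, mul_sub, sub_mul, smul_mul_assoc, mul_smul_comm, mul_assoc,
      Algebra.algebraMap_eq_smul_one, mul_one, one_mul]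
    abel

lemma euler {κ : Type*} [Fintype κ] (b : κ → V)
    (hb : ∀ f : Module.Dual ℝ V, ∑ i, f (b i) • flt (b i) = f) {m : ℕ}
    {x : ExteriorAlgebra ℝ (Module.Dual ℝ V)} (hx : x ∈ ⋀[ℝ]^m (Module.Dual ℝ V)) :
    ∑ i, ι ℝ (flt (b i)) * ctr (b i) x = (m : ℝ) • x := by
  refine ext_ind (p := fun x => ∑ i, ι ℝ (flt (b i)) * ctr (b i) x = (m : ℝ) • x)
    ?_ ?_ ?_ ?_ hx
  · simp
  · intro x z h1 h2
    simp only [map_add, mul_add, Finset.sum_add_distrib, h1, h2, smul_add]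
  · intro a x h
    simp only [map_smul, mul_smul_comm, ← Finset.smul_sum, h]
    rw [smul_comm]
  · clear hx x
    intro u
    induction m with
    | zero => simp [ctr_one]
    | succ m ih =>
      rw [ιMulti_succ_apply]
      have h1 : ∀ i, ι ℝ (flt (b i)) * ctr (b i) (ι ℝ (u 0) * ιMulti ℝ m (Matrix.vecTail u))
          = ι ℝ ((u 0) (b i) • flt (b i)) * ιMulti ℝ m (Matrix.vecTail u)
            + ι ℝ (u 0) * (ι ℝ (flt (b i)) * ctr (b i) (ιMulti ℝ m (Matrix.vecTail u))) := by
        intro i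
        rw [ctr_ι_mul, mul_sub, mul_smul_comm, map_smul, smul_mul_assoc, ← mul_assoc, ← mul_assoc,
          eq_neg_of_add_eq_zero_left (ι_add_mul_swap (R := ℝ) (flt (b i)) (u 0)), neg_mul,
          sub_neg_eq_add]
      simp only [h1]
      rw [Finset.sum_add_distrib, ← Finset.mul_sum, ih, ← Finset.sum_mul, ← map_sum, hb,
        mul_smul_comm]
      push_cast
      rw [add_smul, one_smul, add_comm]

lemma B_adj {B : ExteriorAlgebra ℝ (Module.Dual ℝ V) →ₗ[ℝ]
      ExteriorAlgebra ℝ (Module.Dual ℝ V) →ₗ[ℝ] ℝ}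
    (hB : IsInducedInner B) (v : V) (x y : ExteriorAlgebra ℝ (Module.Dual ℝ V)) :
    B (ctr v x) y = B x (ι ℝ (flt v) * y) := by
  have hx : x ∈ Submodule.span ℝ (Set.range fun x : Σ n, (Fin n → Module.Dual ℝ V) =>
      ιMulti ℝ x.fst x.snd) := by rw [ExteriorAlgebra.ιMulti_span]; trivial
  have hy : y ∈ Submodule.span ℝ (Set.range fun x : Σ n, (Fin n → Module.Dual ℝ V) =>
      ιMulti ℝ x.fst x.snd) := by rw [ExteriorAlgebra.ιMulti_span]; trivial
  induction hx using Submodule.span_induction with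
  | zero => simp
  | add x z _ _ h1 h2 => simp [h1, h2]
  | smul a x _ h => simp [h]
  | mem x hx =>
    obtain ⟨⟨m, u⟩, rfl⟩ := hx
    induction hy using Submodule.span_induction with
    | zero => simp
    | add x z _ _ h1 h2 => simp only [map_add, mul_add, h1, h2]
    | smul a x _ h => simp only [map_smul, mul_smul_comm, h]
    | mem y hy =>
      obtain ⟨⟨q, w⟩, rfl⟩ := hy
      have e : ι ℝ (flt v) * ιMulti ℝ q w
          = ιMulti ℝ (q + 1) (Matrix.vecCons (flt v) w) := by
        rw [ιMulti_succ_apply]; simp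
      dsimp only
      rw [e]
      by_cases hmq : m = q + 1
      · subst hmq
        rw [hB.1, ctr_ιMulti, Matrix.det_succ_column_zero, map_sum, LinearMap.sum_apply]
        refine Finset.sum_congr rfl fun i _ => ?_
        rw [map_smul, LinearMap.smul_apply, hB.1, smul_eq_mul]
        simp only [Matrix.of_apply, Matrix.cons_val_zero, gd_flt]
        rfl
      · rw [hB.2 m (q + 1) hmq _ (ιMulti_mem _ _) _ (ιMulti_mem _ _)]
        cases m with
        | zero => rw [ctr_mem_zero v (ιMulti_mem _ _)]; simp
        | succ m =>
          exact hB.2 m q (by omega) _ (ctr_mem v (ιMulti_mem (m + 1) _)) _ (ιMulti_mem _ _)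

lemma B_nondeg {B : ExteriorAlgebra ℝ (Module.Dual ℝ V) →ₗ[ℝ]
      ExteriorAlgebra ℝ (Module.Dual ℝ V) →ₗ[ℝ] ℝ}
    (hB : IsInducedInner B) {κ : Type*} [Fintype κ] (b : κ → V)
    (hb : ∀ f : Module.Dual ℝ V, ∑ i, f (b i) • flt (b i) = f) (m : ℕ) :
    ∀ z ∈ ⋀[ℝ]^m (Module.Dual ℝ V), (∀ y, B z y = 0) → z = 0 := by
  induction m with
  | zero =>
    intro z hz h
    have h1 : B 1 1 = 1 := by
      have := hB.1 0 0 0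
      simpa using this
    obtain ⟨a, rfl⟩ : ∃ a : ℝ, z = a • 1 := by
      refine ext_ind (p := fun z => ∃ a : ℝ, z = a • 1) ⟨0, by simp⟩ ?_ ?_ ?_ hz
      · rintro _ _ ⟨a, rfl⟩ ⟨c, rfl⟩; exact ⟨a + c, by rw [add_smul]⟩
      · rintro a _ ⟨c, rfl⟩; exact ⟨a * c, by rw [mul_smul]⟩
      · intro u; exact ⟨1, by simp⟩
    have := h 1
    rw [map_smul, LinearMap.smul_apply, h1, smul_eq_mul, mul_one] at this
    rw [this, zero_smul]
  | succ m ih =>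
    intro z hz h
    have h1 : ∀ v, ctr v z = 0 := fun v =>
      ih _ (ctr_mem v hz) fun y => by rw [B_adj hB, h]
    have h2 := euler b hb hz
    simp only [h1, mul_zero, Finset.sum_const_zero] at h2
    exact (smul_eq_zero.1 h2.symm).resolve_left (by positivity)

end KahlerAux

theorem stmt8
    {V : Type*} [NormedAddCommGroup V] [InnerProductSpace ℝ V] [FiniteDimensional ℝ V]
    (n : ℕ) (hdim : Module.finrank ℝ V = 2 * n)
    (J : V →ₗ[ℝ] V) (hJ2 : J ∘ₗ J = -LinearMap.id)
    (hJg : ∀ u v : V, inner (𝕜 := ℝ) (J u) (J v) = inner (𝕜 := ℝ) u v)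
    (ω : ExteriorAlgebra ℝ (Module.Dual ℝ V))
    (hω2 : ω ∈ ⋀[ℝ]^2 (Module.Dual ℝ V))
    (hωJ : ∀ u v : V, formEval ω u v = inner (𝕜 := ℝ) (J u) v)
    (B : ExteriorAlgebra ℝ (Module.Dual ℝ V) →ₗ[ℝ] ExteriorAlgebra ℝ (Module.Dual ℝ V) →ₗ[ℝ] ℝ)
    (hB : IsInducedInner B)
    (Lam : ExteriorAlgebra ℝ (Module.Dual ℝ V) →ₗ[ℝ] ExteriorAlgebra ℝ (Module.Dual ℝ V))
    (hLam : ∀ x y : ExteriorAlgebra ℝ (Module.Dual ℝ V), B (Lam x) y = B x (ω * y))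
    (k : ℕ) (hk : k ≤ n) :
    Set.InjOn (((LinearMap.mulLeft ℝ ω) ^ (n - k)))
      {x | x ∈ ⋀[ℝ]^k (Module.Dual ℝ V) ∧ Lam x = 0} := by
  classical
  set b := stdOrthonormalBasis ℝ V with hbdef
  have hb : ∀ f : Module.Dual ℝ V, ∑ i, f (b i) • flt (b i) = f := by
    intro f
    ext w
    rw [LinearMap.sum_apply]
    simp only [LinearMap.smul_apply, flt_apply, smul_eq_mul]
    conv_rhs => rw [← b.sum_repr' w]
    rw [map_sum]
    refine Finset.sum_congr rfl fun i _ => ?_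
    rw [map_smul, smul_eq_mul, mul_comm]
  have hJJ : ∀ v, J (J v) = -v := fun v => by
    simpa using LinearMap.congr_fun hJ2 v
  have hskew : ∀ u v, inner (𝕜 := ℝ) (J u) v = - inner (𝕜 := ℝ) u (J v) := fun u v => by
    rw [← hJg u (J v), hJJ, inner_neg_right, neg_neg]
  have hbJ : ∀ f : Module.Dual ℝ V, ∑ i, f (J (b i)) • flt (J (b i)) = f := by
    intro f
    ext w
    have := LinearMap.congr_fun (hb (f ∘ₗ J)) (-(J w))
    rw [LinearMap.sum_apply] at this ⊢
    simp only [LinearMap.smul_apply, flt_apply, smul_eq_mul, LinearMap.comp_apply, map_neg, hJJ,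
      neg_neg, inner_neg_right] at this ⊢
    rw [← this]
    refine Finset.sum_congr rfl fun i _ => ?_
    rw [hskew, mul_neg]
  have hcω : ∀ u, ctr u ω = ι ℝ (flt (J u)) := by
    intro u
    have h1 : ctr u ω ∈ ⋀[ℝ]^1 (Module.Dual ℝ V) := ctr_mem u hω2
    obtain ⟨f, hf⟩ : ∃ f, ctr u ω = ι ℝ f := by
      refine ext_ind (p := fun z => ∃ f : Module.Dual ℝ V, z = ι ℝ f) ⟨0, by simp⟩ ?_ ?_ ?_ h1
      · rintro _ _ ⟨a, rfl⟩ ⟨c, rfl⟩; exact ⟨a + c, by rw [map_add]⟩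
      · rintro a _ ⟨c, rfl⟩; exact ⟨a • c, by rw [map_smul]⟩
      · intro u; exact ⟨u 0, by rw [ιMulti_succ_apply]; simp⟩
    rw [hf]
    congr 1
    ext v
    rw [flt_apply, ← hωJ]
    change _ = algebraMapInv (ctr v (ctr u ω))
    rw [hf, ctr_ι]
    exact (algebraMap_leftInverse (R := ℝ) (Module.Dual ℝ V) (f v)).symm
  have h2ω : ∑ i, ι ℝ (flt (b i)) * ι ℝ (flt (J (b i))) = (2 : ℝ) • ω := by
    have := euler b hb hω2
    simp only [hcω] at this
    simpa using this
  -- twice the dual Lefschetz operator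
  let D : ExteriorAlgebra ℝ (Module.Dual ℝ V) →ₗ[ℝ] ExteriorAlgebra ℝ (Module.Dual ℝ V) :=
    ∑ i, ctr (J (b i)) ∘ₗ ctr (b i)
  have hD : ∀ x, D x = ∑ i, ctr (J (b i)) (ctr (b i) x) := fun x => by
    simp [D, LinearMap.sum_apply]
  have hDadj : ∀ x y, B (D x) y = 2 * B x (ω * y) := by
    intro x y
    rw [hD, map_sum, LinearMap.sum_apply]
    simp only [B_adj hB]
    rw [← map_sum]
    simp only [← mul_assoc]
    rw [← Finset.sum_mul, h2ω, smul_mul_assoc, map_smul, smul_eq_mul]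
  have hDcomm : ∀ m : ℕ, ∀ y ∈ ⋀[ℝ]^m (Module.Dual ℝ V),
      D (ω * y) = (2 * ((n : ℝ) - m)) • y + ω * D y := by
    intro m y hy
    have key : ∀ i, ctr (J (b i)) (ctr (b i) (ω * y))
        = y - ι ℝ (flt (J (b i))) * ctr (J (b i)) y - ι ℝ (flt (b i)) * ctr (b i) y
          + ω * ctr (J (b i)) (ctr (b i) y) := by
      intro i
      rw [ctr_mul_two _ hω2, hcω, map_add, ctr_ι_mul, ctr_mul_two _ hω2, hcω, hJJ, flt_apply, hJg]
      have h1 : inner (𝕜 := ℝ) (b i) (b i) = 1 := by simp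
      have h2 : flt (-(b i)) = - flt (b i) := by ext w; simp [flt_apply]
      rw [h1, h2, one_smul, map_neg, neg_mul]
      abel
    rw [hD, hD]
    simp only [key]
    rw [Finset.sum_add_distrib, Finset.sum_sub_distrib, Finset.sum_sub_distrib, euler b hb hy,
      euler (fun i => J (b i)) hbJ hy, Finset.sum_const, Finset.card_univ, Fintype.card_fin,
      ← Finset.mul_sum, ← Nat.cast_smul_eq_nsmul ℝ]
    have hdim' : (Module.finrank ℝ V : ℝ) = 2 * n := by rw [hdim]; push_cast; ring
    rw [hdim']
    module
  have hprim : ∀ x ∈ ⋀[ℝ]^k (Module.Dual ℝ V), Lam x = 0 → D x = 0 := by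
    intro x hx hL
    refine B_nondeg hB b hb (k - 1 - 1) _ ?_ ?_
    · rw [hD]
      exact Submodule.sum_mem _ fun i _ => ctr_mem _ (ctr_mem _ hx)
    · intro y
      rw [hDadj, ← hLam, hL]
      simp
  have hpow : ∀ x ∈ ⋀[ℝ]^k (Module.Dual ℝ V), ∀ r : ℕ,
      ω ^ r * x ∈ ⋀[ℝ]^(k + 2 * r) (Module.Dual ℝ V) := by
    intro x hx r
    induction r with
    | zero => simpa using hx
    | succ r ih =>
      have := SetLike.mul_mem_graded (A := fun i : ℕ => ⋀[ℝ]^i (Module.Dual ℝ V)) hω2 ih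
      rw [← mul_assoc, ← pow_succ'] at this
      convert this using 2
      ring
  have hform : ∀ x ∈ ⋀[ℝ]^k (Module.Dual ℝ V), D x = 0 → ∀ r : ℕ,
      D (ω ^ (r + 1) * x) = (2 * ((r : ℝ) + 1) * ((n : ℝ) - k - r)) • (ω ^ r * x) := by
    intro x hx hDx r
    induction r with
    | zero =>
      rw [pow_succ', mul_assoc, hDcomm _ _ (hpow x hx 0)]
      simp [hDx]
    | succ r ih =>
      rw [pow_succ', mul_assoc, hDcomm _ _ (hpow x hx (r + 1)), ih, mul_smul_comm, ← mul_assoc,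
        ← pow_succ', ← add_smul]
      congr 1
      push_cast
      ring
  have hker : ∀ x ∈ ⋀[ℝ]^k (Module.Dual ℝ V), D x = 0 → ∀ r : ℕ, r ≤ n - k →
      ω ^ r * x = 0 → x = 0 := by
    intro x hx hDx r
    induction r with
    | zero => intro _ h; simpa using h
    | succ r ih =>
      intro hr h
      refine ih (by omega) ?_
      have h1 := hform x hx hDx r
      rw [h, map_zero] at h1
      refine (smul_eq_zero.1 h1.symm).resolve_left ?_
      have h2 : (k : ℝ) + r + 1 ≤ n := by
        have : k + r + 1 ≤ n := by omega
        exact_mod_cast this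
      have h3 : (0 : ℝ) < (n : ℝ) - k - r := by linarith
      positivity
  rintro x ⟨hx, hLx⟩ y ⟨hy, hLy⟩ hxy
  rw [LinearMap.pow_mulLeft, LinearMap.mulLeft_apply, LinearMap.mulLeft_apply] at hxy
  have hs : x - y ∈ ⋀[ℝ]^k (Module.Dual ℝ V) := Submodule.sub_mem _ hx hy
  refine sub_eq_zero.1 (hker (x - y) hs (hprim _ hs ?_) (n - k) le_rfl ?_)
  · rw [map_sub, hLx, hLy, sub_zero]
  · rw [mul_sub, hxy, sub_self]
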